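/- In the ladder graph P_2 □ P_n with n ≥ 2, for i ∈ {1,2} the node resistance curvature of the corner vertex (i,1) equals 1 − α_n, where α_n is the effective resistance across the first rung of P_2 □ P_n; by symmetry the same holds for (i,n). -/

import Mathlib

open Classical Matrix

/-- The four Penrose conditions characterizing the Moore–Penrose pseudoinverse
of a real square matrix. -/
def IsMoorePenroseInverse {V : Type*} [Fintype V] [DecidableEq V]
    (L P : Matrix V V ℝ) : Prop :=
  L * P * L = L ∧ P * L * P = P ∧ (L * P)ᵀ = L * P ∧ (P * L)ᵀ = P * L

/-- The Moore–Penrose pseudoinverse of a real square matrix. -/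
noncomputable def pinv {V : Type*} [Fintype V] [DecidableEq V]
    (L : Matrix V V ℝ) : Matrix V V ℝ :=
  if h : ∃ P, IsMoorePenroseInverse L P then h.choose else 0

/-- Effective resistance between `x` and `y` computed from a (weighted) Laplacian `L`. -/
noncomputable def effResM {V : Type*} [Fintype V] [DecidableEq V]
    (L : Matrix V V ℝ) (x y : V) : ℝ :=
  pinv L x x + pinv L y y - 2 * pinv L x y

/-- Effective resistance between vertices `x` and `y` of a simple graph `G`. -/
noncomputable def effRes {V : Type*} [Fintype V] [DecidableEq V]
    (G : SimpleGraph V) (x y : V) : ℝ :=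
  effResM (G.lapMatrix ℝ) x y

/-- The node resistance curvature `p_x = 1 - (1/2) ∑_{y ~ x} ω_{x,y}`. -/
noncomputable def curv {V : Type*} [Fintype V] [DecidableEq V]
    (G : SimpleGraph V) (x : V) : ℝ :=
  1 - (1/2) * ∑ y : V, if G.Adj x y then effRes G x y else 0

/-- The grid graph `P_m □ P_n` (vertex `(i,j)` of the paper corresponds to
`(⟨i-1⟩, ⟨j-1⟩) : Fin m × Fin n`). -/
def grid (m n : ℕ) : SimpleGraph (Fin m × Fin n) :=
  (SimpleGraph.pathGraph m).boxProd (SimpleGraph.pathGraph n)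

/-- The ladder graph `P_2 □ P_n` (vertex `(i,k)` of the paper corresponds to
`(⟨i-1⟩, ⟨k-1⟩) : Fin 2 × Fin n`). -/
def ladder (n : ℕ) : SimpleGraph (Fin 2 × Fin n) :=
  (SimpleGraph.pathGraph 2).boxProd (SimpleGraph.pathGraph n)

/-- `α_n`, the effective resistance across the first rung of the ladder `P_2 □ P_n`,
i.e. between the vertices `(1,1)` and `(2,1)` of the paper (junk value `0` for `n = 0`). -/
noncomputable def alpha (n : ℕ) : ℝ :=
  if h : 0 < n then effRes (ladder n) (0, ⟨0, h⟩) (1, ⟨0, h⟩) else 0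

section aux

variable {V : Type*} [Fintype V] [DecidableEq V]

theorem mp_unique {L P Q : Matrix V V ℝ} (hP : IsMoorePenroseInverse L P)
    (hQ : IsMoorePenroseInverse L Q) : P = Q := by
  obtain ⟨p1, p2, p3, p4⟩ := hP
  obtain ⟨q1, q2, q3, q4⟩ := hQ
  have h1 : L * P = L * Q := by
    have h : (L * P)ᵀ = (L * Q * (L * P))ᵀ := by
      rw [← Matrix.mul_assoc, q1]
    rw [Matrix.transpose_mul (L * Q), p3, q3] at h
    rw [h, ← Matrix.mul_assoc, p1]
  have h2 : P * L = Q * L := by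
    have h : (P * L)ᵀ = (P * L * (Q * L))ᵀ := by
      rw [Matrix.mul_assoc P, ← Matrix.mul_assoc L, q1]
    rw [Matrix.transpose_mul (P * L), p4, q4] at h
    rw [h, Matrix.mul_assoc Q, ← Matrix.mul_assoc L, p1]
  calc P = P * L * P := p2.symm
    _ = Q * L * P := by rw [h2]
    _ = Q * (L * P) := Matrix.mul_assoc _ _ _
    _ = Q * L * Q := by rw [h1, ← Matrix.mul_assoc]
    _ = Q := q2

theorem pinv_eq {L P : Matrix V V ℝ} (hP : IsMoorePenroseInverse L P) : pinv L = P := by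
  have h : ∃ P, IsMoorePenroseInverse L P := ⟨P, hP⟩
  unfold pinv
  rw [dif_pos h]
  exact mp_unique h.choose_spec hP

/-- averaging matrix -/
noncomputable def avg (V : Type*) [Fintype V] : Matrix V V ℝ :=
  Matrix.of fun _ _ => (Fintype.card V : ℝ)⁻¹

theorem pinv_lap (G : SimpleGraph V) [DecidableRel G.Adj] (hG : G.Connected) :
    pinv (G.lapMatrix ℝ) = (G.lapMatrix ℝ + avg V)⁻¹ - avg V ∧
    G.lapMatrix ℝ * pinv (G.lapMatrix ℝ) = 1 - avg V ∧
    (pinv (G.lapMatrix ℝ))ᵀ = pinv (G.lapMatrix ℝ) := by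
  have hne : Nonempty V := hG.nonempty
  have hc : (Fintype.card V : ℝ) ≠ 0 := by exact_mod_cast Fintype.card_ne_zero
  set L := G.lapMatrix ℝ with hL
  set J := avg V with hJ
  have hLt : Lᵀ = L := G.isSymm_lapMatrix (R := ℝ)
  have hJt : Jᵀ = J := by ext; simp [hJ, avg]
  have hJJ : J * J = J := by
    ext x y
    simp [hJ, avg, Matrix.mul_apply]
  have hLJ : L * J = 0 := by
    ext x y
    have := congrFun (G.lapMatrix_mulVec_const_eq_zero (R := ℝ)) x
    simp only [Matrix.mulVec, dotProduct, mul_one, Pi.zero_apply] at this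
    simp only [Matrix.mul_apply, hJ, avg, Matrix.of_apply, ← Finset.sum_mul, Matrix.zero_apply]
    rw [this, zero_mul]
  have hJL : J * L = 0 := by
    have := congrArg Matrix.transpose hLJ
    rwa [Matrix.transpose_mul, hLt, hJt, Matrix.transpose_zero] at this
  set M := L + J with hM
  have hdet : IsUnit M.det := by
    rw [isUnit_iff_ne_zero]
    intro h0
    obtain ⟨v, hv0, hv⟩ := Matrix.exists_mulVec_eq_zero_iff.mpr h0
    have hJv : J *ᵥ v = 0 := by
      have : J *ᵥ (M *ᵥ v) = 0 := by rw [hv, Matrix.mulVec_zero]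
      rwa [Matrix.mulVec_mulVec, hM, Matrix.mul_add, hJL, hJJ, zero_add] at this
    have hLv : L *ᵥ v = 0 := by
      rwa [hM, Matrix.add_mulVec, hJv, add_zero] at hv
    rw [hL, SimpleGraph.lapMatrix_mulVec_eq_zero_iff_forall_reachable] at hLv
    apply hv0
    ext x
    have h2 := congrFun hJv x
    simp only [Matrix.mulVec, dotProduct, hJ, avg, Matrix.of_apply] at h2
    rw [Finset.sum_congr rfl (fun y _ => by rw [hLv y x (hG.preconnected y x)])] at h2
    simpa [hc] using h2
  have hMJ : M * J = J := by rw [hM, Matrix.add_mul, hLJ, hJJ, zero_add]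
  have hJM : J * M = J := by rw [hM, Matrix.mul_add, hJL, hJJ, zero_add]
  have hI : M⁻¹ * M = 1 := Matrix.nonsing_inv_mul _ hdet
  have hI' : M * M⁻¹ = 1 := Matrix.mul_nonsing_inv _ hdet
  have hIJ : M⁻¹ * J = J := by
    calc M⁻¹ * J = M⁻¹ * (M * J) := by rw [hMJ]
      _ = J := by rw [← Matrix.mul_assoc, hI, one_mul]
  have hJI : J * M⁻¹ = J := by
    calc J * M⁻¹ = (J * M) * M⁻¹ := by rw [hJM]
      _ = J := by rw [Matrix.mul_assoc, hI', mul_one]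
  have hLM : L = M - J := by rw [hM]; simp
  have e1 : L * (M⁻¹ - J) = 1 - J := by
    rw [Matrix.mul_sub, hLJ, sub_zero, hLM, Matrix.sub_mul, hI', hJI]
  have e2 : (M⁻¹ - J) * L = 1 - J := by
    rw [Matrix.sub_mul, hJL, sub_zero, hLM, Matrix.mul_sub, hI, hIJ]
  have hmp : IsMoorePenroseInverse L (M⁻¹ - J) := by
    refine ⟨?_, ?_, ?_, ?_⟩
    · rw [e1, Matrix.sub_mul, hJL, one_mul, sub_zero]
    · rw [e2, Matrix.sub_mul, one_mul, Matrix.mul_sub, hJI, hJJ, sub_self, sub_zero]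
    · rw [e1]; simp [hJt]
    · rw [e2]; simp [hJt]
  have hp := pinv_eq hmp
  refine ⟨hp, by rw [hp, e1], ?_⟩
  rw [hp, Matrix.transpose_sub, hJt, Matrix.transpose_nonsing_inv, hM, Matrix.transpose_add,
    hLt, hJt]

theorem effRes_comm' (G : SimpleGraph V) (hG : G.Connected) (x y : V) :
    effRes G x y = effRes G y x := by
  have h := congrFun (congrFun (pinv_lap G hG).2.2 x) y
  rw [Matrix.transpose_apply] at h
  unfold effRes effResM
  rw [h]; ring

theorem effRes_iso (G : SimpleGraph V) (hG : G.Connected) (e : G ≃g G) (x y : V) :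
    effRes G (e x) (e y) = effRes G x y := by
  have hs : (G.lapMatrix ℝ + avg V).submatrix e.toEquiv e.toEquiv = G.lapMatrix ℝ + avg V := by
    ext a b
    have hd : G.degree (e a) = G.degree a := by
      convert e.degree_eq a
    have he : e a = e b ↔ a = b := e.injective.eq_iff
    simp only [Matrix.submatrix_apply, Matrix.add_apply, SimpleGraph.lapMatrix, avg,
      Matrix.sub_apply, SimpleGraph.degMatrix, Matrix.diagonal_apply, SimpleGraph.adjMatrix_apply,
      Matrix.of_apply]
    have hA : G.Adj (e a) (e b) ↔ G.Adj a b := e.map_adj_iff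
    simp [hd, he, hA]
  have hi : ((G.lapMatrix ℝ + avg V)⁻¹).submatrix e.toEquiv e.toEquiv
      = (G.lapMatrix ℝ + avg V)⁻¹ := by
    rw [← Matrix.inv_submatrix_equiv, hs]
  have key : ∀ a b, pinv (G.lapMatrix ℝ) (e a) (e b) = pinv (G.lapMatrix ℝ) a b := by
    intro a b
    have := congrFun (congrFun hi a) b
    rw [(pinv_lap G hG).1, Matrix.sub_apply, Matrix.sub_apply, ← this]
    rfl
  unfold effRes effResM
  simp only [key]

theorem curv_deg_two (G : SimpleGraph V) (hG : G.Connected) (a b c : V) (hbc : b ≠ c)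
    (h : ∀ y, G.Adj a y ↔ y = b ∨ y = c) : curv G a = 1 - effRes G a b := by
  have hab : a ≠ b := ((h b).2 (Or.inl rfl)).ne
  have hac : a ≠ c := ((h c).2 (Or.inr rfl)).ne
  have hsum : ∀ f : V → ℝ, (∑ y : V, if G.Adj a y then f y else 0) = f b + f c := by
    intro f
    rw [← Finset.sum_filter]
    have : (Finset.univ.filter fun y => G.Adj a y) = {b, c} := by
      ext y; simp [h]
    rw [this, Finset.sum_pair hbc]
  obtain ⟨-, h2, h3⟩ := pinv_lap G hG
  have hsym : ∀ x y, pinv (G.lapMatrix ℝ) x y = pinv (G.lapMatrix ℝ) y x := fun x y =>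
    congrFun (congrFun h3 y) x
  have hrow : ∀ x, (G.lapMatrix ℝ * pinv (G.lapMatrix ℝ)) a x =
      G.degree a * pinv (G.lapMatrix ℝ) a x -
      (pinv (G.lapMatrix ℝ) b x + pinv (G.lapMatrix ℝ) c x) := by
    intro x
    rw [← hsum (fun y => pinv (G.lapMatrix ℝ) y x), Matrix.mul_apply]
    generalize pinv (G.lapMatrix ℝ) = P
    simp [SimpleGraph.lapMatrix, SimpleGraph.degMatrix, Matrix.diagonal_apply, sub_mul,
      Finset.sum_sub_distrib, SimpleGraph.adjMatrix_apply]
  have hdeg : (G.degree a : ℝ) = 2 := by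
    have : G.neighborFinset a = {b, c} := by
      ext y; simp [h]
    rw [← SimpleGraph.card_neighborFinset_eq_degree, this, Finset.card_pair hbc]; norm_num
  have r1 := hrow b
  have r2 := hrow c
  rw [h2, hdeg] at r1 r2
  simp only [Matrix.sub_apply, Matrix.one_apply_ne hab, Matrix.one_apply_ne hac, avg,
    Matrix.of_apply] at r1 r2
  have s := hsym b c
  have hw : effRes G a c = effRes G a b := by
    unfold effRes effResM
    linarith
  unfold curv
  rw [hsum (fun y => effRes G a y), hw]; ring

end aux

theorem ladder_conn (n : ℕ) : (ladder (n + 2)).Connected :=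
  (SimpleGraph.pathGraph_connected 1).boxProd (SimpleGraph.pathGraph_connected (n + 1))

/-- reflection -/
def ladderRev (n : ℕ) : ladder n ≃g ladder n where
  toEquiv := (Equiv.refl _).prodCongr Fin.revPerm
  map_rel_iff' := by
    rintro ⟨a, b⟩ ⟨c, d⟩
    simp only [ladder, SimpleGraph.boxProd_adj, SimpleGraph.pathGraph_adj, Equiv.prodCongr_apply,
      Prod.map, Equiv.refl_apply, Fin.revPerm_apply, Fin.val_rev, Fin.ext_iff]
    omega

theorem effRes_rung (n : ℕ) (i : Fin 2) :
    effRes (ladder (n + 2)) (i, 0) (i.rev, 0) = alpha (n + 2) := by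
  have ha : alpha (n + 2) = effRes (ladder (n + 2)) (0, 0) (1, 0) := by
    unfold alpha
    rw [dif_pos (by omega)]
    rfl
  rw [ha]
  fin_cases i
  · rfl
  · exact effRes_comm' _ (ladder_conn n) _ _

theorem corner_curv (n : ℕ) (hn : 2 ≤ n) (i : Fin 2) :
    curv (ladder n) (i, ⟨0, by omega⟩) = 1 - alpha n ∧
    curv (ladder n) (i, ⟨n - 1, by omega⟩) = 1 - alpha n := by
  obtain ⟨m, rfl⟩ : ∃ m, n = m + 2 := ⟨n - 2, by omega⟩
  have hc := ladder_conn m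
  have hr := effRes_rung m i
  constructor
  · rw [← hr]
    refine curv_deg_two _ hc _ (i.rev, 0) (i, ⟨1, by omega⟩) ?_ ?_
    · simp [Prod.ext_iff, Fin.ext_iff]
    · rintro ⟨c, d⟩
      simp only [ladder, SimpleGraph.boxProd_adj, SimpleGraph.pathGraph_adj, Prod.ext_iff,
        Fin.val_rev, Fin.ext_iff, Fin.val_zero]
      omega
  · rw [← hr, ← effRes_iso _ hc (ladderRev (m + 2))]
    have e1 : ∀ j, ladderRev (m + 2) (j, 0) = (j, ⟨m + 2 - 1, by omega⟩) := by
      intro j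
      simp [ladderRev, Prod.ext_iff, Fin.ext_iff]
    rw [e1, e1]
    refine curv_deg_two _ hc _ _ (i, ⟨m, by omega⟩) ?_ ?_
    · simp [Prod.ext_iff, Fin.ext_iff]
    · rintro ⟨c, d⟩
      simp only [ladder, SimpleGraph.boxProd_adj, SimpleGraph.pathGraph_adj, Prod.ext_iff,
        Fin.val_rev, Fin.ext_iff]
      omega
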